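/- Let P be a real polynomial of degree at most d in n real variables and, for 0 ≤ m ≤ d, let P_m denote its m-homogeneous part. Then ‖P_m‖_{[-1,1]^n} ≤ M_{m,d} · ‖P‖_{[-1,1]^n}, and in particular ‖P_m‖_{[-1,1]^n} ≤ (1+√2)^d · ‖P‖_{[-1,1]^n}. Moreover, the constant 1+√2 is optimal: if C > 0 is such that ‖P_m‖_{[-1,1]^n} ≤ C^d ‖P‖_{[-1,1]^n} for all n, d, all real polynomials P of degree at most d and all 0 ≤ m ≤ d, then C ≥ 1+√2. -/

import Mathlib

open Finset

/-- The Markov number `M_{m,d}`: the absolute value of the coefficient of `t^m` in the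
Chebyshev polynomial `T_d` if `m ≡ d (mod 2)`, and in `T_{d-1}` if `m ≡ d - 1 (mod 2)`. -/
noncomputable def markovNum (m d : ℕ) : ℝ :=
  if m % 2 = d % 2 then |(Polynomial.Chebyshev.T ℝ (d : ℤ)).coeff m|
  else |(Polynomial.Chebyshev.T ℝ ((d : ℤ) - 1)).coeff m|

/-- The sup norm of a real polynomial in `n` variables over the cube `[-1,1]^n`. -/
noncomputable def supOnBox {n : ℕ} (P : MvPolynomial (Fin n) ℝ) : ℝ :=
  sSup {y : ℝ | ∃ x : Fin n → ℝ, (∀ i, x i ∈ Set.Icc (-1 : ℝ) 1) ∧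
    y = |MvPolynomial.eval x P|}

open Polynomial in
/-- The coefficients of a real polynomial with nonnegative roots alternate in sign. -/
theorem prod_X_sub_C_coeff_alternating {ι : Type*} (s : Finset ι) (u : ι → ℝ)
    (hu : ∀ i ∈ s, 0 ≤ u i) (j : ℕ) :
    0 ≤ (-1 : ℝ) ^ (#s + j) * (∏ i ∈ s, (X - C (u i))).coeff j := by
  classical
  induction s using Finset.induction_on generalizing j with
  | empty =>
    rcases eq_or_ne j 0 with rfl | hj
    · simp
    · simp [coeff_one, hj]
  | insert a s ha ih =>
    have ih' := ih fun i hi => hu i (mem_insert_of_mem hi)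
    have hua := hu a (mem_insert_self a s)
    rw [prod_insert ha, card_insert_of_notMem ha, sub_mul, coeff_sub, coeff_C_mul]
    have hlow := mul_nonneg hua (ih' j)
    cases j with
    | zero =>
      rw [mul_coeff_zero, coeff_X_zero]
      calc (0 : ℝ) ≤ _ := hlow
        _ = _ := by ring
    | succ j =>
      rw [coeff_X_mul]
      calc (0 : ℝ) ≤ _ := add_nonneg hlow (ih' j)
        _ = _ := by ring

/-- Products of differences of a strictly decreasing sequence alternate in sign. -/
theorem prod_erase_sub_alternating {N k : ℕ} {u : ℕ → ℝ}
    (hanti : StrictAntiOn u (range (N + 1))) (hk : k ≤ N) :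
    0 < (-1 : ℝ) ^ k * ∏ j ∈ (range (N + 1)).erase k, (u k - u j) := by
  have hlt : ∀ {i j}, j ≤ N → i < j → u j < u i := fun {i j} hj hij =>
    hanti (by simp; omega) (by simp; omega) hij
  have hsplit : (range (N + 1)).erase k = range k ∪ Ioc k N := by grind
  have hdisj : Disjoint (range k) (Ioc k N) := by grind [Finset.disjoint_iff_ne]
  have hleft : 0 < ∏ j ∈ range k, (-1 : ℝ) * (u k - u j) := prod_pos fun j hj => by
    linarith [hlt hk (mem_range.mp hj)]
  rw [prod_mul_distrib, prod_const, card_range] at hleft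
  have hright : 0 < ∏ j ∈ Ioc k N, (u k - u j) := prod_pos fun j hj => by
    linarith [hlt (mem_Ioc.mp hj).2 (mem_Ioc.mp hj).1]
  rw [hsplit, prod_union hdisj, ← mul_assoc]
  exact mul_pos hleft hright

open Polynomial in
/-- If `g` alternates on a decreasing sequence of `N + 1` nonnegative nodes and dominates `f` there,
then every coefficient of `f` is dominated by that of `g`. -/
theorem abs_coeff_le_of_alternating {N : ℕ} {u : ℕ → ℝ}
    (hanti : StrictAntiOn u (range (N + 1))) (hu : ∀ k ≤ N, 0 ≤ u k) {f g : ℝ[X]}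
    (hf : f.natDegree ≤ N) (hg : g.natDegree ≤ N)
    (hfg : ∀ k ≤ N, |f.eval (u k)| ≤ (-1) ^ k * g.eval (u k)) (j : ℕ) :
    |f.coeff j| ≤ |g.coeff j| := by
  set c : ℕ → ℝ := fun k => (∏ i ∈ (range (N + 1)).erase k, (u k - u i))⁻¹ *
    (∏ i ∈ (range (N + 1)).erase k, (X - C (u i))).coeff j with hc
  have hrep : ∀ p : ℝ[X], p.natDegree ≤ N →
      p.coeff j = ∑ k ∈ range (N + 1), p.eval (u k) * c k := fun p hp => by
    have hdeg : p.degree < #(range (N + 1)) := by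
      rw [card_range]
      exact degree_le_natDegree.trans_lt (by exact_mod_cast Nat.lt_succ_of_le hp)
    conv_lhs => rw [Lagrange.eq_interpolate hanti.injOn hdeg, Lagrange.interpolate_eq_sum]
    simp [finsetSum_coeff, coeff_C_mul, hc, div_eq_mul_inv, mul_assoc]
  have hsign : ∀ k ≤ N, 0 ≤ (-1 : ℝ) ^ k * (-1) ^ (N + j) * c k := fun k hk => by
    have hden := inv_pos.mpr (prod_erase_sub_alternating hanti hk)
    have hnum := prod_X_sub_C_coeff_alternating ((range (N + 1)).erase k) u
      (fun i hi => hu i (by simp at hi; omega)) j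
    rw [card_erase_of_mem (by simp; omega), card_range, Nat.add_sub_cancel] at hnum
    rw [mul_inv, ← inv_pow, inv_neg_one] at hden
    calc (0 : ℝ) ≤ _ := mul_nonneg hden.le hnum
      _ = _ := by rw [hc]; ring
  have habs : ∀ k ≤ N, |c k| = (-1 : ℝ) ^ k * (-1) ^ (N + j) * c k := fun k hk => by
    rw [← abs_of_nonneg (hsign k hk)]
    simp [abs_mul]
  calc |f.coeff j| ≤ ∑ k ∈ range (N + 1), |f.eval (u k) * c k| := by
        rw [hrep f hf]; exact abs_sum_le_sum_abs _ _
    _ ≤ ∑ k ∈ range (N + 1), (-1) ^ (N + j) * (g.eval (u k) * c k) := by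
        refine sum_le_sum fun k hk => ?_
        have hk' : k ≤ N := by simpa [Nat.lt_succ_iff] using hk
        rw [abs_mul]
        calc _ ≤ (-1) ^ k * g.eval (u k) * |c k| :=
              mul_le_mul_of_nonneg_right (hfg k hk') (abs_nonneg _)
          _ = ((-1) ^ k * (-1) ^ k) * ((-1) ^ (N + j) * (g.eval (u k) * c k)) := by
              rw [habs k hk']; ring
          _ = _ := by rw [← mul_pow]; simp
    _ = (-1) ^ (N + j) * g.coeff j := by rw [← mul_sum, ← hrep g hg]
    _ ≤ |g.coeff j| := (le_abs_self _).trans (by simp [abs_mul])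

open Polynomial in
/-- The polynomial `q` whose coefficients are those of `p` at indices `2 * k + ε`. -/
noncomputable def parityPart (ε : ℕ) (p : ℝ[X]) : ℝ[X] := contract 2 (divX^[ε] p)

open Polynomial in
theorem coeff_parityPart (ε : ℕ) (p : ℝ[X]) (k : ℕ) :
    (parityPart ε p).coeff k = p.coeff (2 * k + ε) := by
  have hiter : ∀ (e : ℕ) (q : ℝ[X]) (i : ℕ), (divX^[e] q).coeff i = q.coeff (i + e) := by
    intro e
    induction e with
    | zero => simp
    | succ e ih => intro q i; rw [Function.iterate_succ_apply, ih, coeff_divX, add_assoc]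
  rw [parityPart, coeff_contract two_ne_zero, hiter, mul_comm]

open Polynomial in
theorem eval_eq_parityPart (p : ℝ[X]) (x : ℝ) :
    p.eval x = (parityPart 0 p).eval (x ^ 2) + x * (parityPart 1 p).eval (x ^ 2) := by
  have key : p = expand ℝ 2 (parityPart 0 p) + X * expand ℝ 2 (parityPart 1 p) := by
    ext k
    rcases k with _ | k
    · simp [coeff_expand, coeff_parityPart]
    · rw [coeff_add, coeff_X_mul, coeff_expand two_pos, coeff_expand two_pos, coeff_parityPart,
        coeff_parityPart]
      rcases Nat.even_or_odd' k with ⟨l, rfl | rfl⟩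
      · rw [if_neg (by omega), if_pos (by omega), zero_add]
        congr 1; omega
      · rw [if_pos (by omega), if_neg (by omega), add_zero]
        congr 1; omega
  conv_lhs => rw [key]
  simp [expand_eval]

open Polynomial in
theorem two_mul_pow_mul_eval_parityPart {ε : ℕ} (hε : ε < 2) (p : ℝ[X]) (x : ℝ) :
    2 * (x ^ ε * (parityPart ε p).eval (x ^ 2)) = p.eval x + (-1) ^ ε * p.eval (-x) := by
  rw [eval_eq_parityPart p x, eval_eq_parityPart p (-x), neg_sq]
  interval_cases ε <;> ring

open Polynomial in
theorem natDegree_parityPart_le {N ε : ℕ} {p : ℝ[X]} (hp : p.natDegree ≤ 2 * N + ε + 1) :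
    (parityPart ε p).natDegree ≤ N := by
  rw [natDegree_le_iff_coeff_eq_zero]
  intro k hk
  rw [coeff_parityPart]
  exact coeff_eq_zero_of_natDegree_lt (by omega)

open Polynomial.Chebyshev in
theorem node_pos_of_two_mul_lt {D k : ℕ} (hk : 2 * k < D) : 0 < node D k := by
  have hD : (0 : ℝ) < D := by exact_mod_cast (by omega : 0 < D)
  refine Real.cos_pos_of_mem_Ioo ⟨?_, ?_⟩
  · have : 0 ≤ (k : ℝ) * Real.pi / D := by positivity
    linarith [Real.pi_pos]
  · rw [div_lt_div_iff₀ hD two_pos]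
    have : (2 * k : ℝ) < D := by exact_mod_cast hk
    nlinarith [Real.pi_pos]

open Polynomial.Chebyshev in
theorem node_nonneg_of_two_mul_le {D k : ℕ} (hk : 2 * k ≤ D) : 0 ≤ node D k := by
  rcases hk.lt_or_eq with h | rfl
  · exact (node_pos_of_two_mul_lt h).le
  · rcases Nat.eq_zero_or_pos k with rfl | hk0
    · simp [node]
    · have : (k : ℝ) ≠ 0 := by positivity
      refine (Eq.symm ?_).le
      rw [node, show (k : ℝ) * Real.pi / ((2 * k : ℕ) : ℝ) = Real.pi / 2 by
        push_cast; field_simp, Real.cos_pi_div_two]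

open Polynomial Polynomial.Chebyshev in
/-- V. A. Markov's coefficient inequality on `[-1, 1]`. -/
theorem abs_coeff_le_mul_abs_coeff_T {D m : ℕ} (hm : m ≤ D) (hpar : m % 2 = D % 2) {p : ℝ[X]}
    (hp : p.natDegree ≤ D + 1) {M : ℝ} (hM : ∀ x ∈ Set.Icc (-1 : ℝ) 1, |p.eval x| ≤ M) :
    |p.coeff m| ≤ |(T ℝ (D : ℤ)).coeff m| * M := by
  obtain ⟨N, ε, hε, rfl⟩ : ∃ N ε, ε < 2 ∧ D = 2 * N + ε :=
    ⟨D / 2, D % 2, Nat.mod_lt _ two_pos, (Nat.div_add_mod D 2).symm⟩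
  obtain ⟨j, rfl⟩ : ∃ j, m = 2 * j + ε := ⟨m / 2, by omega⟩
  set D := 2 * N + ε with hD
  have hM0 : 0 ≤ M := (abs_nonneg _).trans (hM 0 (by simp))
  have hT : ∀ x : ℝ, x ^ ε * (parityPart ε (T ℝ (D : ℤ))).eval (x ^ 2) = (T ℝ (D : ℤ)).eval x := by
    intro x
    have h := two_mul_pow_mul_eval_parityPart hε (T ℝ (D : ℤ)) x
    rw [T_eval_neg] at h
    have hs : (-1 : ℝ) ^ ε * (((D : ℤ).negOnePow : ℤ) : ℝ) = 1 := by
      rw [Int.negOnePow_def, zpow_natCast, hD]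
      push_cast
      rw [pow_add, pow_mul]
      interval_cases ε <;> simp
    rw [← mul_assoc ((-1 : ℝ) ^ ε), hs] at h
    linarith
  have key := abs_coeff_le_of_alternating (N := N) (u := fun k => node D k ^ 2)
    (f := parityPart ε p) (g := C M * parityPart ε (T ℝ (D : ℤ))) ?_ (fun k _ => sq_nonneg _)
    (natDegree_parityPart_le hp)
    ((natDegree_C_mul_le _ _).trans (natDegree_parityPart_le
      (by rw [natDegree_T, Int.natAbs_natCast]; omega))) ?_ j
  · rw [coeff_C_mul, coeff_parityPart, coeff_parityPart, abs_mul, abs_of_nonneg hM0] at key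
    linarith
  · intro a ha b hb hab
    simp only [coe_range, Set.mem_Iio] at ha hb
    exact pow_lt_pow_left₀ (node_lt (by omega) hab) (node_nonneg_of_two_mul_le (by omega))
      two_ne_zero
  · intro k hk
    have hx : 0 < node D k ^ ε := by
      interval_cases ε
      · simp
      · simpa using node_pos_of_two_mul_lt (D := D) (k := k) (by omega)
    have hmem : node D k ∈ Set.Icc (-1 : ℝ) 1 := node_mem_Icc
    refine le_of_mul_le_mul_left ?_ hx
    calc node D k ^ ε * |(parityPart ε p).eval (node D k ^ 2)|
        = |node D k ^ ε * (parityPart ε p).eval (node D k ^ 2)| := by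
          rw [abs_mul, abs_of_pos hx]
      _ ≤ M := by
          have h := two_mul_pow_mul_eval_parityPart hε p (node D k)
          have h1 := hM _ hmem
          have h2 := hM (-node D k) ⟨by linarith [hmem.2], by linarith [hmem.1]⟩
          have h3 := abs_add_le (p.eval (node D k)) ((-1) ^ ε * p.eval (-node D k))
          rw [← h, abs_mul 2, abs_mul ((-1) ^ ε), abs_neg_one_pow, abs_two] at h3
          linarith
      _ = M * ((-1) ^ k * (T ℝ (D : ℤ)).eval (node D k)) := by
          rw [eval_T_real_node (by simp; omega), ← mul_pow]; simp
      _ = _ := by rw [← hT, eval_mul, eval_C]; ring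

open Polynomial in
theorem abs_coeff_le_markovNum_mul {d m : ℕ} (hm : m ≤ d) {p : ℝ[X]} (hp : p.natDegree ≤ d)
    {M : ℝ} (hM : ∀ x ∈ Set.Icc (-1 : ℝ) 1, |p.eval x| ≤ M) :
    |p.coeff m| ≤ markovNum m d * M := by
  rw [markovNum]
  split_ifs with h
  · exact abs_coeff_le_mul_abs_coeff_T hm h (by omega) hM
  · obtain ⟨e, rfl⟩ : ∃ e, d = e + 1 := ⟨d - 1, by omega⟩
    simpa using abs_coeff_le_mul_abs_coeff_T (D := e) (by omega) (by omega) hp hM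

theorem one_add_sqrt_two_sq : (1 + √2 : ℝ) ^ 2 = 2 * (1 + √2) + 1 := by
  nlinarith [Real.sq_sqrt (show (0 : ℝ) ≤ 2 by norm_num)]

open Polynomial Polynomial.Chebyshev in
theorem abs_coeff_T_le (n m : ℕ) : |(T ℝ (n : ℤ)).coeff m| ≤ (1 + √2) ^ n := by
  induction n using Nat.twoStepInduction generalizing m with
  | zero =>
    rcases eq_or_ne m 0 with rfl | h
    · simp
    · simp [coeff_one, h]
  | one =>
    have h2 := Real.sqrt_nonneg 2
    simp only [Nat.cast_one, T_one, coeff_X, pow_one]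
    split_ifs <;> norm_num
    linarith
  | more n ih₁ ih₂ =>
    have hrec : T ℝ ((n + 2 : ℕ) : ℤ) = C 2 * (X * T ℝ ((n + 1 : ℕ) : ℤ)) - T ℝ (n : ℤ) := by
      push_cast
      rw [T_add_two, ← mul_assoc]; rfl
    have hX : |(X * T ℝ ((n + 1 : ℕ) : ℤ)).coeff m| ≤ (1 + √2) ^ (n + 1) := by
      cases m with
      | zero => simp; positivity
      | succ m => rw [coeff_X_mul]; exact ih₂ m
    rw [hrec, coeff_sub, coeff_C_mul]
    calc _ ≤ 2 * |(X * T ℝ ((n + 1 : ℕ) : ℤ)).coeff m| + |(T ℝ (n : ℤ)).coeff m| := by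
          refine (abs_sub _ _).trans ?_
          rw [abs_mul, abs_two]
      _ ≤ 2 * (1 + √2) ^ (n + 1) + (1 + √2) ^ n := by linarith [ih₁ m]
      _ = (1 + √2) ^ (n + 2) := by rw [pow_add _ n 2, one_add_sqrt_two_sq]; ring

theorem markovNum_le {m d : ℕ} (hm : m ≤ d) : markovNum m d ≤ (1 + √2) ^ d := by
  rw [markovNum]
  split_ifs with h
  · exact abs_coeff_T_le d m
  · obtain ⟨e, rfl⟩ : ∃ e, d = e + 1 := ⟨d - 1, by omega⟩
    have h1 : (1 : ℝ) ≤ 1 + √2 := by linarith [Real.sqrt_nonneg 2]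
    calc _ ≤ (1 + √2) ^ e := by simpa using abs_coeff_T_le e m
      _ ≤ _ := pow_le_pow_right₀ h1 (Nat.le_succ e)

open MvPolynomial in
theorem bddAbove_abs_eval_box {n : ℕ} (P : MvPolynomial (Fin n) ℝ) :
    BddAbove {y : ℝ | ∃ x : Fin n → ℝ, (∀ i, x i ∈ Set.Icc (-1 : ℝ) 1) ∧ y = |eval x P|} := by
  have hcpt : IsCompact (Set.univ.pi fun _ : Fin n => Set.Icc (-1 : ℝ) 1) :=
    isCompact_univ_pi fun _ => isCompact_Icc
  refine (hcpt.bddAbove_image (f := fun x => |eval x P|)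
    (MvPolynomial.continuous_eval P).abs.continuousOn).mono ?_
  rintro _ ⟨x, hx, rfl⟩
  exact ⟨x, fun i _ => hx i, rfl⟩

theorem abs_eval_le_supOnBox {n : ℕ} (P : MvPolynomial (Fin n) ℝ) {x : Fin n → ℝ}
    (hx : ∀ i, x i ∈ Set.Icc (-1 : ℝ) 1) : |MvPolynomial.eval x P| ≤ supOnBox P :=
  le_csSup (bddAbove_abs_eval_box P) ⟨x, hx, rfl⟩

theorem supOnBox_le {n : ℕ} (P : MvPolynomial (Fin n) ℝ) {M : ℝ}
    (hM : ∀ x : Fin n → ℝ, (∀ i, x i ∈ Set.Icc (-1 : ℝ) 1) → |MvPolynomial.eval x P| ≤ M) :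
    supOnBox P ≤ M := by
  refine csSup_le ⟨_, 0, by simp, rfl⟩ ?_
  rintro _ ⟨x, hx, rfl⟩
  exact hM x hx

theorem supOnBox_nonneg {n : ℕ} (P : MvPolynomial (Fin n) ℝ) : 0 ≤ supOnBox P :=
  (abs_nonneg _).trans (abs_eval_le_supOnBox P (x := 0) (by simp))

/-- The restriction of a polynomial to the line through the origin and `x`. -/
noncomputable def lineRestriction {n : ℕ} (x : Fin n → ℝ) (P : MvPolynomial (Fin n) ℝ) :
    Polynomial ℝ :=
  MvPolynomial.aeval (fun i => Polynomial.C (x i) * Polynomial.X) P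

theorem eval_lineRestriction {n : ℕ} (x : Fin n → ℝ) (P : MvPolynomial (Fin n) ℝ) (t : ℝ) :
    (lineRestriction x P).eval t = MvPolynomial.eval (fun i => x i * t) P := by
  induction P using MvPolynomial.induction_on with
  | C a => simp [lineRestriction]
  | add p q hp hq => simpa [lineRestriction] using congrArg₂ (· + ·) hp hq
  | mul_X p i hp => simp_all [lineRestriction]

theorem lineRestriction_monomial {n : ℕ} (x : Fin n → ℝ) (s : Fin n →₀ ℕ) (a : ℝ) :
    lineRestriction x (MvPolynomial.monomial s a) =
      Polynomial.C (MvPolynomial.eval x (MvPolynomial.monomial s a)) * Polynomial.X ^ s.degree := by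
  rw [lineRestriction, MvPolynomial.aeval_monomial, MvPolynomial.eval_monomial,
    Finsupp.degree_apply]
  simp [mul_pow, Finsupp.prod, prod_mul_distrib, prod_pow_eq_pow_sum, mul_assoc, map_prod,
    Polynomial.algebraMap_eq]

theorem coeff_lineRestriction {n : ℕ} (x : Fin n → ℝ) (P : MvPolynomial (Fin n) ℝ) (m : ℕ) :
    (lineRestriction x P).coeff m =
      MvPolynomial.eval x (MvPolynomial.homogeneousComponent m P) := by
  induction P using MvPolynomial.induction_on' with
  | monomial s a =>
    rw [lineRestriction_monomial, Polynomial.coeff_C_mul, Polynomial.coeff_X_pow]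
    have hs := MvPolynomial.isHomogeneous_monomial a (rfl : s.degree = s.degree)
    rw [MvPolynomial.homogeneousComponent_of_mem (m := m) hs]
    split_ifs <;> simp
  | add p q hp hq => simpa [lineRestriction] using congrArg₂ (· + ·) hp hq

theorem natDegree_lineRestriction_le {n d : ℕ} (x : Fin n → ℝ) {P : MvPolynomial (Fin n) ℝ}
    (hP : P.totalDegree ≤ d) : (lineRestriction x P).natDegree ≤ d := by
  rw [Polynomial.natDegree_le_iff_coeff_eq_zero]
  intro k hk
  rw [coeff_lineRestriction, MvPolynomial.homogeneousComponent_eq_zero _ _ (by omega), map_zero]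

theorem supOnBox_homogeneousComponent_le {n d m : ℕ} {P : MvPolynomial (Fin n) ℝ}
    (hP : P.totalDegree ≤ d) (hm : m ≤ d) :
    supOnBox (MvPolynomial.homogeneousComponent m P) ≤ markovNum m d * supOnBox P := by
  refine supOnBox_le _ fun x hx => ?_
  rw [← coeff_lineRestriction]
  refine abs_coeff_le_markovNum_mul hm (natDegree_lineRestriction_le x hP) fun t ht => ?_
  rw [eval_lineRestriction]
  refine abs_eval_le_supOnBox P fun i => ?_
  rw [Set.mem_Icc, ← abs_le, abs_mul]
  exact mul_le_one₀ (abs_le.mpr (hx i)) (abs_nonneg _) (abs_le.mpr ht)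

open Polynomial Polynomial.Chebyshev in
/-- The modulus of the Chebyshev polynomial at the imaginary unit grows like `(1 + √2) ^ n`. -/
theorem exists_eval_T_I (n : ℕ) : ∃ a : ℝ, (1 + √2) ^ n ≤ 3 * a ∧
    (T ℂ (n : ℤ)).eval Complex.I = a * Complex.I ^ n := by
  suffices h : ∃ a b : ℝ, ((1 + √2) ^ n ≤ 3 * a ∧ (1 + √2) ^ (n + 1) ≤ 3 * b) ∧
      (T ℂ (n : ℤ)).eval Complex.I = a * Complex.I ^ n ∧
      (T ℂ ((n : ℤ) + 1)).eval Complex.I = b * Complex.I ^ (n + 1) by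
    obtain ⟨a, b, ⟨ha, -⟩, hb, -⟩ := h
    exact ⟨a, ha, hb⟩
  induction n with
  | zero =>
    have h2 : √2 ≤ 2 := Real.sqrt_le_iff.mpr (by norm_num)
    exact ⟨1, 1, ⟨by norm_num, by norm_num; linarith⟩, by simp, by simp⟩
  | succ n ih =>
    obtain ⟨a, b, ⟨ha, hb⟩, hTa, hTb⟩ := ih
    refine ⟨b, 2 * b + a, ⟨hb, ?_⟩, by exact_mod_cast hTb, ?_⟩
    · calc (1 + √2) ^ (n + 1 + 1) = 2 * (1 + √2) ^ (n + 1) + (1 + √2) ^ n := by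
            rw [add_assoc, pow_add _ n (1 + 1), one_add_one_eq_two, one_add_sqrt_two_sq]; ring
        _ ≤ 3 * (2 * b + a) := by linarith
    · have hrec : T ℂ (((n + 1 : ℕ) : ℤ) + 1) = 2 * X * T ℂ ((n : ℤ) + 1) - T ℂ (n : ℤ) := by
        rw [← T_add_two]; congr 1
      rw [hrec, eval_sub, eval_mul, eval_mul, eval_X, hTa, hTb]
      have hI : Complex.I ^ (n + 1 + 1) = -Complex.I ^ n := by
        rw [add_assoc, pow_add]; simp
      have hI' : Complex.I * Complex.I ^ (n + 1) = -Complex.I ^ n := by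
        rw [← hI]; ring
      push_cast
      rw [hI, eval_ofNat]
      linear_combination 2 * (b : ℂ) * hI'

open Polynomial Polynomial.Chebyshev in
theorem pow_le_sum_abs_coeff_T (d : ℕ) :
    (1 + √2) ^ d ≤ 3 * ∑ m ∈ range (d + 1), |(T ℝ (d : ℤ)).coeff m| := by
  obtain ⟨a, ha, hT⟩ := exists_eval_T_I d
  refine ha.trans (mul_le_mul_of_nonneg_left ?_ (by norm_num))
  calc a ≤ ‖(T ℂ (d : ℤ)).eval Complex.I‖ := by
        rw [hT, norm_mul, norm_pow, Complex.norm_I, one_pow, mul_one, Complex.norm_real]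
        exact le_abs_self a
    _ = ‖∑ m ∈ range (d + 1), ((T ℝ (d : ℤ)).coeff m : ℂ) * Complex.I ^ m‖ := by
        rw [← aeval_T (R := ℝ), aeval_eq_sum_range, natDegree_T, Int.natAbs_natCast]
        simp
    _ ≤ _ := by
        refine (norm_sum_le _ _).trans (le_of_eq (sum_congr rfl fun m _ => ?_))
        simp

open Polynomial in
/-- A univariate polynomial as a polynomial in a single indexed variable. -/
noncomputable def toMvFinOne (p : ℝ[X]) : MvPolynomial (Fin 1) ℝ :=
  aeval (MvPolynomial.X 0) p

open Polynomial in
theorem eval_toMvFinOne (p : ℝ[X]) (x : Fin 1 → ℝ) :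
    MvPolynomial.eval x (toMvFinOne p) = p.eval (x 0) := by
  have h := hom_eval₂ p (algebraMap ℝ (MvPolynomial (Fin 1) ℝ)) (MvPolynomial.eval x)
    (MvPolynomial.X 0)
  rw [toMvFinOne, aeval_def, h, MvPolynomial.eval_X, MvPolynomial.algebraMap_eq]
  simp [eval₂_eq_sum, eval_eq_sum]

open Polynomial in
theorem totalDegree_toMvFinOne_le (p : ℝ[X]) : (toMvFinOne p).totalDegree ≤ p.natDegree := by
  rw [toMvFinOne, aeval_eq_sum_range]
  refine MvPolynomial.totalDegree_finsetSum_le fun i hi => ?_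
  refine (MvPolynomial.totalDegree_smul_le _ _).trans ?_
  rw [MvPolynomial.totalDegree_X_pow]
  simpa [Nat.lt_succ_iff] using hi

open Polynomial in
theorem abs_coeff_le_supOnBox_toMvFinOne (p : ℝ[X]) (m : ℕ) :
    |p.coeff m| ≤ supOnBox (MvPolynomial.homogeneousComponent m (toMvFinOne p)) := by
  have hp : lineRestriction 1 (toMvFinOne p) = p :=
    Polynomial.funext fun t => by rw [eval_lineRestriction, eval_toMvFinOne]; simp
  conv_lhs => rw [← hp, coeff_lineRestriction]
  exact abs_eval_le_supOnBox _ (by simp)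

open Polynomial Polynomial.Chebyshev in
theorem one_add_sqrt_two_le_of_homogeneous_bound {C : ℝ} (hC : 0 < C)
    (h : ∀ (n d : ℕ) (P : MvPolynomial (Fin n) ℝ), P.totalDegree ≤ d → ∀ m, m ≤ d →
      supOnBox (MvPolynomial.homogeneousComponent m P) ≤ C ^ d * supOnBox P) :
    1 + √2 ≤ C := by
  have hcoeff : ∀ d m : ℕ, m ≤ d → |(T ℝ (d : ℤ)).coeff m| ≤ C ^ d := fun d m hm => by
    have hdeg := (totalDegree_toMvFinOne_le (T ℝ (d : ℤ))).trans_eq (natDegree_T ℝ (d : ℤ))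
    have hsup : supOnBox (toMvFinOne (T ℝ (d : ℤ))) ≤ 1 := supOnBox_le _ fun x hx => by
      rw [eval_toMvFinOne]
      exact abs_eval_T_real_le_one _ (abs_le.mpr (hx 0))
    calc _ ≤ _ := abs_coeff_le_supOnBox_toMvFinOne _ m
      _ ≤ _ := h 1 d _ (by simpa using hdeg) m hm
      _ ≤ C ^ d * 1 := by gcongr
      _ = _ := mul_one _
  have hgrowth : ∀ d : ℕ, (1 + √2) ^ d ≤ 3 * ((d + 1) * C ^ d) := fun d => by
    refine (pow_le_sum_abs_coeff_T d).trans (mul_le_mul_of_nonneg_left ?_ (by norm_num))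
    refine (sum_le_sum fun m hm => hcoeff d m (by simpa [Nat.lt_succ_iff] using hm)).trans ?_
    simp
  by_contra! hlt
  have hr : 1 < (1 + √2) / C := (one_lt_div hC).mpr hlt
  have hlim := ((tendsto_pow_const_div_const_pow_of_one_lt 1 hr).const_mul 3).add
    ((tendsto_pow_const_div_const_pow_of_one_lt 0 hr).const_mul 3)
  have hge : ∀ d : ℕ, 1 ≤ 3 * ((d : ℝ) ^ 1 / ((1 + √2) / C) ^ d) +
      3 * ((d : ℝ) ^ 0 / ((1 + √2) / C) ^ d) := fun d => by
    have hpos : 0 < ((1 + √2) / C) ^ d := by positivity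
    rw [← mul_add, ← add_div, ← mul_div_assoc, one_le_div hpos, div_pow,
      div_le_iff₀ (by positivity)]
    simpa [mul_assoc] using hgrowth d
  have := ge_of_tendsto' hlim hge
  norm_num at this

/-- For a real polynomial `P` of degree at most `d`, the sup norm on `[-1,1]^n` of its
`m`-homogeneous part is at most `M_{m,d}` (hence at most `(1+√2)^d`) times that of `P`;
moreover the constant `1 + √2` is optimal for bounds of the form `C^d`. -/
theorem homogeneous_part_markov_bound :
    (∀ (n d : ℕ) (P : MvPolynomial (Fin n) ℝ), P.totalDegree ≤ d → ∀ m, m ≤ d →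
      supOnBox (MvPolynomial.homogeneousComponent m P) ≤ markovNum m d * supOnBox P ∧
      supOnBox (MvPolynomial.homogeneousComponent m P)
        ≤ (1 + Real.sqrt 2) ^ d * supOnBox P) ∧
    (∀ C : ℝ, 0 < C →
      (∀ (n d : ℕ) (P : MvPolynomial (Fin n) ℝ), P.totalDegree ≤ d → ∀ m, m ≤ d →
        supOnBox (MvPolynomial.homogeneousComponent m P) ≤ C ^ d * supOnBox P) →
      1 + Real.sqrt 2 ≤ C) := by
  exact ⟨fun n d P hP m hm => ⟨supOnBox_homogeneousComponent_le hP hm,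
    (supOnBox_homogeneousComponent_le hP hm).trans
      (mul_le_mul_of_nonneg_right (markovNum_le hm) (supOnBox_nonneg P))⟩,
    fun C hC h => one_add_sqrt_two_le_of_homogeneous_bound hC h⟩
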